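/- arXiv:1601.02307 — 3 statements merged into one kernel-verified Lean document; each statement's English description precedes it below -/
import Mathlib

section
/- Composition of corelations is associative: for all types X, Y, Z, W and corelations α : Setoid (X ⊕ Y), β : Setoid (Y ⊕ Z), γ : Setoid (Z ⊕ W), one has γ ∘ (β ∘ α) = (γ ∘ β) ∘ α as Setoids on X ⊕ W. -/
open Sum Relation

/-- The evident inclusion `X ⊕ Z → X ⊕ Y ⊕ Z`. -/
def Corel.incl {X Z : Type*} (Y : Type*) : X ⊕ Z → X ⊕ Y ⊕ Z
  | inl x => inl x
  | inr z => inr (inr z)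

/-- Image of an element of `X ⊕ Y ⊕ Z` in the `X ⊕ Y` summands, if it lies there. -/
def Corel.toXY {X Y Z : Type*} : X ⊕ Y ⊕ Z → Option (X ⊕ Y)
  | inl x => some (inl x)
  | inr (inl y) => some (inr y)
  | inr (inr _) => none

/-- Image of an element of `X ⊕ Y ⊕ Z` in the `Y ⊕ Z` summands, if it lies there. -/
def Corel.toYZ {X Y Z : Type*} : X ⊕ Y ⊕ Z → Option (Y ⊕ Z)
  | inl _ => none
  | inr w => some w

/-- The relation `R` on `X ⊕ Y ⊕ Z` generated by `α` and `β`. -/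
def Corel.glue {X Y Z : Type*} (α : Setoid (X ⊕ Y)) (β : Setoid (Y ⊕ Z)) :
    (X ⊕ Y ⊕ Z) → (X ⊕ Y ⊕ Z) → Prop := fun u v =>
  (∃ a b, Corel.toXY u = some a ∧ Corel.toXY v = some b ∧ α.r a b) ∨
  (∃ a b, Corel.toYZ u = some a ∧ Corel.toYZ v = some b ∧ β.r a b)

/-- The composite of the corelations `α : X → Y` and `β : Y → Z` (diagrammatic
order: the result is the corelation `β ∘ α : X → Z`). -/
def Corel.comp {X Y Z : Type*} (α : Setoid (X ⊕ Y)) (β : Setoid (Y ⊕ Z)) :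
    Setoid (X ⊕ Z) :=
  Setoid.comap (Corel.incl Y) (EqvGen.setoid (Corel.glue α β))

/-- The identity corelation on `X`. -/
def Corel.id (X : Type*) : Setoid (X ⊕ X) :=
  EqvGen.setoid fun u v => ∃ x : X, u = inl x ∧ v = inr x

/-- A setoid is determined by the predicates that are constant on its classes. -/
theorem Setoid.eq_of_forall_le_ker_iff {A : Type*} {s t : Setoid A}
    (h : ∀ P : A → Prop, s ≤ Setoid.ker P ↔ t ≤ Setoid.ker P) : s = t := by
  have key : ∀ {s t : Setoid A}, (∀ P : A → Prop, t ≤ Setoid.ker P → s ≤ Setoid.ker P) →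
      s ≤ t := by
    intro s t h a b hab
    have hP : t ≤ Setoid.ker (fun c => t a c) := fun c d hcd =>
      propext ⟨fun hc => t.trans hc hcd, fun hd => t.trans hd (t.symm hcd)⟩
    have hab' : t a a = t a b := h _ hP hab
    exact hab' ▸ t.refl a
  exact le_antisymm (key fun P => (h P).2) (key fun P => (h P).1)

/-- The generated relation on `X ⊕ Y ⊕ Z` lies in the kernel of a map as soon as both
corelations do. -/
theorem Corel.eqvGen_glue_le_ker {X Y Z A : Type*} {α : Setoid (X ⊕ Y)} {β : Setoid (Y ⊕ Z)}
    {f : X → A} {g : Y → A} {h : Z → A}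
    (hα : α ≤ Setoid.ker (Sum.elim f g)) (hβ : β ≤ Setoid.ker (Sum.elim g h)) :
    EqvGen.setoid (Corel.glue α β) ≤ Setoid.ker (Sum.elim f (Sum.elim g h)) := by
  have hXY : ∀ (u : X ⊕ Y ⊕ Z) (a : X ⊕ Y), Corel.toXY u = some a →
      Sum.elim f (Sum.elim g h) u = Sum.elim f g a := by
    rintro (x | y | z) a ha <;> cases ha <;> rfl
  have hYZ : ∀ (u : X ⊕ Y ⊕ Z) (a : Y ⊕ Z), Corel.toYZ u = some a →
      Sum.elim f (Sum.elim g h) u = Sum.elim g h a := by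
    rintro (x | y | z) a ha <;> cases ha <;> rfl
  intro u v huv
  induction huv with
  | rel u v huv =>
    rcases huv with ⟨a, b, ha, hb, hab⟩ | ⟨a, b, ha, hb, hab⟩
    · exact (hXY u a ha).trans ((hα hab).trans (hXY v b hb).symm)
    · exact (hYZ u a ha).trans ((hβ hab).trans (hYZ v b hb).symm)
  | refl u => rfl
  | symm u v _ ih => exact ih.symm
  | trans u v w _ _ ihuv ihvw => exact ihuv.trans ihvw

/-- A predicate on `X ⊕ Z` respects a composite iff it extends over `Y` to one respecting both
factors. -/
theorem Corel.comp_le_ker_iff {X Y Z : Type*} {α : Setoid (X ⊕ Y)} {β : Setoid (Y ⊕ Z)}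
    {p : X → Prop} {r : Z → Prop} :
    Corel.comp α β ≤ Setoid.ker (Sum.elim p r) ↔
      ∃ q : Y → Prop, α ≤ Setoid.ker (Sum.elim p q) ∧ β ≤ Setoid.ker (Sum.elim q r) := by
  constructor
  · intro h
    let E := EqvGen.setoid (Corel.glue α β)
    let P : X ⊕ Y ⊕ Z → Prop := fun u => ∃ i, E (Corel.incl Y i) u ∧ Sum.elim p r i
    have hP : ∀ {u v}, E u v → P u = P v := fun huv => propext
      ⟨fun ⟨i, hi, hpi⟩ => ⟨i, E.trans hi huv, hpi⟩,
        fun ⟨i, hi, hpi⟩ => ⟨i, E.trans hi (E.symm huv), hpi⟩⟩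
    have hincl : ∀ i, P (Corel.incl Y i) = Sum.elim p r i := fun i => propext
      ⟨fun ⟨j, hj, hpj⟩ => (h (show Corel.comp α β j i from hj) :
        Sum.elim p r j = Sum.elim p r i) ▸ hpj, fun hi => ⟨i, E.refl _, hi⟩⟩
    have hX : ∀ x, P (inl x) = p x := fun x => hincl (inl x)
    have hZ : ∀ z, P (inr (inr z)) = r z := fun z => hincl (inr z)
    refine ⟨fun y => P (inr (inl y)), ?_, ?_⟩
    · have hα : ∀ a : X ⊕ Y, ∃ u : X ⊕ Y ⊕ Z, Corel.toXY u = some a ∧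
          P u = Sum.elim p (fun y => P (inr (inl y))) a := by
        rintro (x | y)
        · exact ⟨inl x, rfl, hX x⟩
        · exact ⟨inr (inl y), rfl, rfl⟩
      intro a b hab
      obtain ⟨u, hu, hPu⟩ := hα a
      obtain ⟨v, hv, hPv⟩ := hα b
      exact hPu.symm.trans ((hP (EqvGen.rel _ _ (Or.inl ⟨a, b, hu, hv, hab⟩))).trans hPv)
    · have hβ : ∀ b : Y ⊕ Z, P (inr b) = Sum.elim (fun y => P (inr (inl y))) r b := by
        rintro (y | z)
        · rfl
        · exact hZ z
      intro a b hab
      exact (hβ a).symm.trans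
        ((hP (EqvGen.rel _ _ (Or.inr ⟨a, b, rfl, rfl, hab⟩))).trans (hβ b))
  · rintro ⟨q, hα, hβ⟩ u v huv
    have hincl : ∀ i : X ⊕ Z,
        Sum.elim p (Sum.elim q r) (Corel.incl Y i) = Sum.elim p r i := by
      rintro (x | z) <;> rfl
    exact (hincl u).symm.trans ((Corel.eqvGen_glue_le_ker hα hβ huv).trans (hincl v))

theorem corel_comp_assoc {X Y Z W : Type*} (α : Setoid (X ⊕ Y)) (β : Setoid (Y ⊕ Z))
    (γ : Setoid (Z ⊕ W)) :
    Corel.comp (Corel.comp α β) γ = Corel.comp α (Corel.comp β γ) := by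
  refine Setoid.eq_of_forall_le_ker_iff fun P => ?_
  rw [← Sum.elim_comp_inl_inr P]
  simp only [Corel.comp_le_ker_iff]
  constructor
  · rintro ⟨r, ⟨q, hα, hβ⟩, hγ⟩
    exact ⟨q, hα, r, hβ, hγ⟩
  · rintro ⟨q, hα, r, hβ, hγ⟩
    exact ⟨r, ⟨q, hα, hβ⟩, hγ⟩
end

section
/- The identity corelation is a two-sided unit for composition of corelations: for every corelation α : Setoid (X ⊕ Y), one has α ∘ (id_X) = α and (id_Y) ∘ α = α, where id_X denotes the identity corelation on X. -/
open Sum Relation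

namespace Corel

theorem id_rel_inl_inr {X : Type*} (x : X) : (Corel.id X).r (inl x) (inr x) :=
  EqvGen.rel _ _ ⟨x, rfl, rfl⟩

theorem elim_eq_of_id_rel {X : Type*} {a b : X ⊕ X} (h : (Corel.id X).r a b) :
    Sum.elim _root_.id _root_.id a = Sum.elim _root_.id _root_.id b := by
  have hle : Corel.id X ≤ Setoid.ker (Sum.elim _root_.id _root_.id) := by
    refine Setoid.eqvGen_le ?_
    rintro _ _ ⟨x, rfl, rfl⟩
    rfl
  exact hle h

/-- A composite corelation lies below `γ` if the gluing relation is carried into `γ` by a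
retraction of the inclusion of the outer summands. -/
theorem comp_le_of_retraction {X Y Z : Type*} {α : Setoid (X ⊕ Y)} {β : Setoid (Y ⊕ Z)}
    {γ : Setoid (X ⊕ Z)} (r : X ⊕ Y ⊕ Z → X ⊕ Z) (hr : ∀ a, r (incl Y a) = a)
    (h : ∀ u v, glue α β u v → γ (r u) (r v)) : comp α β ≤ γ := by
  intro a b hab
  have hle : EqvGen.setoid (glue α β) ≤ Setoid.comap r γ := Setoid.eqvGen_le h
  have key : γ (r (incl Y a)) (r (incl Y b)) := hle hab
  rwa [hr, hr] at key

/-- A corelation `γ` lies below a composite if some map `s` carries `γ` into the gluing relation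
and agrees with the inclusion of the outer summands up to the generated equivalence. -/
theorem le_comp_of_section {X Y Z : Type*} {α : Setoid (X ⊕ Y)} {β : Setoid (Y ⊕ Z)}
    {γ : Setoid (X ⊕ Z)} (s : X ⊕ Z → X ⊕ Y ⊕ Z)
    (hs : ∀ a, EqvGen (glue α β) (incl Y a) (s a))
    (h : ∀ a b, γ a b → glue α β (s a) (s b)) : γ ≤ comp α β := fun a b hab =>
  ((hs a).trans _ _ _ (.rel _ _ (h a b hab))).trans _ _ _ ((hs b).symm _ _)

theorem id_comp {X Y : Type*} (α : Setoid (X ⊕ Y)) : comp (Corel.id X) α = α := by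
  refine le_antisymm (comp_le_of_retraction (Sum.elim inl _root_.id) ?_ ?_)
    (le_comp_of_section inr ?_ ?_)
  · rintro (x | y) <;> rfl
  · have key : ∀ (u : X ⊕ X ⊕ Y) a, toXY u = some a →
        Sum.elim inl _root_.id u = (inl (Sum.elim _root_.id _root_.id a) : X ⊕ Y) := by
      rintro (x | x | y) a ⟨⟩ <;> rfl
    rintro u v (⟨a, b, hu, hv, h⟩ | ⟨a, b, hu, hv, h⟩)
    · rw [key u a hu, key v b hv, elim_eq_of_id_rel h]
    · rcases u with x | u <;> rcases v with x' | v <;> cases hu <;> cases hv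
      exact h
  · rintro (x | y)
    · exact .rel _ _ (.inl ⟨_, _, rfl, rfl, id_rel_inl_inr x⟩)
    · exact .refl _
  · exact fun a b hab => .inr ⟨a, b, rfl, rfl, hab⟩

theorem comp_id {X Y : Type*} (α : Setoid (X ⊕ Y)) : comp α (Corel.id Y) = α := by
  refine le_antisymm
    (comp_le_of_retraction (Sum.map _root_.id (Sum.elim _root_.id _root_.id)) ?_ ?_)
    (le_comp_of_section (Sum.map _root_.id inl) ?_ ?_)
  · rintro (x | y) <;> rfl
  · have key : ∀ (u : X ⊕ Y ⊕ Y) a, toXY u = some a →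
        Sum.map _root_.id (Sum.elim _root_.id _root_.id) u = a := by
      rintro (x | y | y) a ⟨⟩ <;> rfl
    rintro u v (⟨a, b, hu, hv, h⟩ | ⟨a, b, hu, hv, h⟩)
    · rw [key u a hu, key v b hv]
      exact h
    · rcases u with x | u <;> rcases v with x' | v <;> cases hu <;> cases hv
      rw [Sum.map_inr, Sum.map_inr, elim_eq_of_id_rel h]
  · rintro (x | y)
    · exact .refl _
    · exact .symm _ _ (.rel _ _ (.inr ⟨_, _, rfl, rfl, id_rel_inl_inr y⟩))
  · have key : ∀ a : X ⊕ Y, toXY (Sum.map _root_.id inl a : X ⊕ Y ⊕ Y) = some a := by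
      rintro (x | y) <;> rfl
    exact fun a b hab => .inl ⟨a, b, key a, key b, hab⟩

end Corel

theorem corel_comp_id {X Y : Type*} (α : Setoid (X ⊕ Y)) :
    Corel.comp (Corel.id X) α = α ∧ Corel.comp α (Corel.id Y) = α :=
  ⟨Corel.id_comp α, Corel.comp_id α⟩
end

section
/- Alternating-chain characterization of corelation composition: for corelations α : Setoid (X ⊕ Y) and β : Setoid (Y ⊕ Z), the composite β ∘ α relates Sum.inl x and Sum.inr z (for x : X, z : Z) if and only if there exist k ≥ 1 and elements y₁, …, y_k of Y such that α relates Sum.inl x to Sum.inr y₁, β relates Sum.inl y_k to Sum.inr z, and for each 1 ≤ i < k, either β relates Sum.inl y_i to Sum.inl y_{i+1} or α relates Sum.inr y_i to Sum.inr y_{i+1}. -/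
open Sum Relation

/-- Two points are joined by the reflexive transitive closure of `r` iff there is a finite
`r`-chain from one to the other. -/
theorem Relation.reflTransGen_iff_exists_fin_chain {A : Type*} {r : A → A → Prop} {a b : A} :
    ReflTransGen r a b ↔
      ∃ (k : ℕ) (y : Fin (k + 1) → A), y 0 = a ∧ y (Fin.last k) = b ∧
        ∀ i : Fin k, r (y i.castSucc) (y i.succ) := by
  constructor
  · intro h
    induction h using ReflTransGen.head_induction_on with
    | refl => exact ⟨0, fun _ => b, rfl, rfl, fun i => i.elim0⟩
    | @head a c hac _ ih =>
      obtain ⟨k, y, h0, hl, hy⟩ := ih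
      refine ⟨k + 1, Fin.cons a y, rfl, ?_, fun i => ?_⟩
      · rw [← Fin.succ_last, Fin.cons_succ, hl]
      · refine Fin.cases ?_ (fun j => ?_) i
        · rw [Fin.castSucc_zero, Fin.cons_zero, Fin.cons_succ, h0]
          exact hac
        · rw [← Fin.succ_castSucc, Fin.cons_succ, Fin.cons_succ]
          exact hy j
  · rintro ⟨k, y, rfl, rfl, hy⟩
    suffices ∀ i, ReflTransGen r (y 0) (y i) from this _
    intro i
    induction i using Fin.induction with
    | zero => exact .refl
    | succ i ih => exact ih.tail (hy i)

namespace Corel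

variable {X Y Z : Type*}

/-- Two elements of `Y` are adjacent if they are related by `β` or by `α`. -/
def Adj (α : Setoid (X ⊕ Y)) (β : Setoid (Y ⊕ Z)) (y y' : Y) : Prop :=
  β.r (inl y) (inl y') ∨ α.r (inr y) (inr y')

/-- `y` is reachable from `x` by an `α`-step into `Y` followed by steps within `Y`. -/
def Reach (α : Setoid (X ⊕ Y)) (β : Setoid (Y ⊕ Z)) (x : X) (y : Y) : Prop :=
  ∃ y₀, α.r (inl x) (inr y₀) ∧ ReflTransGen (Adj α β) y₀ y

/-- Explicit description of the equivalence class of `x` under the relation generated by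
`glue α β`. -/
def InClass (α : Setoid (X ⊕ Y)) (β : Setoid (Y ⊕ Z)) (x : X) : X ⊕ Y ⊕ Z → Prop
  | inl x' => α.r (inl x) (inl x') ∨ ∃ y, Reach α β x y ∧ α.r (inr y) (inl x')
  | inr (inl y) => Reach α β x y
  | inr (inr z) => ∃ y, Reach α β x y ∧ β.r (inl y) (inr z)

variable {α : Setoid (X ⊕ Y)} {β : Setoid (Y ⊕ Z)} {x : X}

theorem Reach.of_rel {y : Y} (h : α.r (inl x) (inr y)) : Reach α β x y :=
  ⟨y, h, .refl⟩

theorem Reach.tail {y y' : Y} (h : Reach α β x y) (hy : Adj α β y y') : Reach α β x y' :=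
  let ⟨y₀, h₀, hr⟩ := h
  ⟨y₀, h₀, hr.tail hy⟩

theorem glue_symm {u v : X ⊕ Y ⊕ Z} (h : glue α β u v) : glue α β v u := by
  rcases h with ⟨a, b, ha, hb, h⟩ | ⟨a, b, ha, hb, h⟩
  · exact .inl ⟨b, a, hb, ha, α.symm' h⟩
  · exact .inr ⟨b, a, hb, ha, β.symm' h⟩

theorem InClass.of_glue {u v : X ⊕ Y ⊕ Z} (h : glue α β u v) (hu : InClass α β x u) :
    InClass α β x v := by
  rcases h with ⟨a, b, ha, hb, h⟩ | ⟨a, b, ha, hb, h⟩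
  · rcases u with x₁ | y₁ | z₁ <;> rcases v with x₂ | y₂ | z₂ <;> cases ha <;> cases hb
    · rcases hu with hu | ⟨y, hy, hu⟩
      · exact .inl (α.trans' hu h)
      · exact .inr ⟨y, hy, α.trans' hu h⟩
    · rcases hu with hu | ⟨y, hy, hu⟩
      · exact .of_rel (α.trans' hu h)
      · exact hy.tail (.inr (α.trans' hu h))
    · exact .inr ⟨y₁, hu, h⟩
    · exact Reach.tail hu (.inr h)
  · rcases u with x₁ | y₁ | z₁ <;> rcases v with x₂ | y₂ | z₂ <;> cases ha <;> cases hb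
    · exact Reach.tail hu (.inl h)
    · exact ⟨y₁, hu, h⟩
    · obtain ⟨y, hy, hu⟩ := hu
      exact hy.tail (.inl (β.trans' hu h))
    · obtain ⟨y, hy, hu⟩ := hu
      exact ⟨y, hy, β.trans' hu h⟩

theorem inClass_iff_of_eqvGen {u v : X ⊕ Y ⊕ Z} (h : EqvGen (glue α β) u v) :
    InClass α β x u ↔ InClass α β x v := by
  induction h with
  | rel _ _ h => exact ⟨.of_glue h, .of_glue (glue_symm h)⟩
  | refl => exact Iff.rfl
  | symm _ _ _ ih => exact ih.symm
  | trans _ _ _ _ _ ih₁ ih₂ => exact ih₁.trans ih₂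

theorem Reach.eqvGen {y : Y} (h : Reach α β x y) :
    EqvGen (glue α β) (inl x) (inr (inl y)) := by
  obtain ⟨y₀, h₀, hr⟩ := h
  induction hr with
  | refl => exact .rel _ _ (.inl ⟨_, _, rfl, rfl, h₀⟩)
  | tail _ hs ih =>
    refine ih.trans _ _ _ (.rel _ _ ?_)
    rcases hs with hs | hs
    · exact .inr ⟨_, _, rfl, rfl, hs⟩
    · exact .inl ⟨_, _, rfl, rfl, hs⟩

theorem comp_rel_iff_exists_reach {z : Z} :
    (comp α β).r (inl x) (inr z) ↔ ∃ y, Reach α β x y ∧ β.r (inl y) (inr z) := by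
  change EqvGen (glue α β) (inl x) (inr (inr z)) ↔ _
  constructor
  · intro h
    exact (inClass_iff_of_eqvGen (x := x) h).1 (.inl (α.refl' _))
  · rintro ⟨y, hy, hz⟩
    exact hy.eqvGen.trans _ _ _ (.rel _ _ (.inr ⟨_, _, rfl, rfl, hz⟩))

end Corel

/-- Alternating-chain characterization of corelation composition: the composite `β ∘ α`
relates `x : X` to `z : Z` iff there is a finite nonempty alternating chain of elements
of `Y` (here of length `k + 1`, so at least one) joining them. -/
theorem corel_comp_rel_iff_chain {X Y Z : Type*} (α : Setoid (X ⊕ Y)) (β : Setoid (Y ⊕ Z))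
    (x : X) (z : Z) :
    (Corel.comp α β).r (inl x) (inr z) ↔
      ∃ (k : ℕ) (y : Fin (k + 1) → Y),
        α.r (inl x) (inr (y 0)) ∧
        β.r (inl (y (Fin.last k))) (inr z) ∧
        ∀ i : Fin k,
          β.r (inl (y i.castSucc)) (inl (y i.succ)) ∨
          α.r (inr (y i.castSucc)) (inr (y i.succ)) := by
  rw [Corel.comp_rel_iff_exists_reach]
  constructor
  · rintro ⟨_, ⟨_, h₀, hr⟩, hz⟩
    obtain ⟨k, y, rfl, rfl, hy⟩ := reflTransGen_iff_exists_fin_chain.1 hr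
    exact ⟨k, y, h₀, hz, hy⟩
  · rintro ⟨k, y, h₀, hz, hy⟩
    exact ⟨_, ⟨_, h₀, reflTransGen_iff_exists_fin_chain.2 ⟨k, y, rfl, rfl, hy⟩⟩, hz⟩
end
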